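/- arXiv:1511.06014 — 3 statements merged into one kernel-verified Lean document; each statement's English description precedes it below -/
import Mathlib

section
/- Let X ~ N(0, σ²) with σ² ≥ 0 and let A be any measurable event with 0 < P(A) < 1. Then E[1_A · X] ≤ P(A) · √(2 σ² log(1/P(A))). -/
open MeasureTheory ProbabilityTheory
open scoped NNReal ENNReal

namespace GittinsPaper

/-- A random variable with Gaussian law `N(0, v)` is sub-Gaussian with variance proxy `v`. -/
lemma hasSubgaussianMGF_of_map_eq_gaussianReal {Ω : Type*} {mΩ : MeasurableSpace Ω}
    {μ : Measure Ω} {v : ℝ≥0} {X : Ω → ℝ} (hX : μ.map X = gaussianReal 0 v) :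
    HasSubgaussianMGF X v μ where
  integrable_exp_mul t := by
    have hXm : AEMeasurable X μ := AEMeasurable.of_map_ne_zero (by simp [hX, NeZero.ne])
    have h := integrable_exp_mul_gaussianReal (μ := 0) (v := v) t
    rw [← hX] at h
    exact h.comp_aemeasurable hXm
  mgf_le t := by simp [mgf_gaussianReal hX t]

/-- The Donsker–Varadhan bound for the integral of a sub-Gaussian variable over an event. -/
lemma mul_setIntegral_le_of_hasSubgaussianMGF {Ω : Type*} {mΩ : MeasurableSpace Ω}
    {μ : Measure Ω} [IsFiniteMeasure μ] {c : ℝ≥0} {X : Ω → ℝ} (hX : HasSubgaussianMGF X c μ)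
    {A : Set Ω} (hA : 0 < μ.real A) (t : ℝ) :
    t * ∫ ω in A, X ω ∂μ ≤ μ.real A * (c * t ^ 2 / 2 + Real.log (1 / μ.real A)) := by
  set b := c * t ^ 2 / 2 + Real.log (1 / μ.real A) with hb
  have hexp : Integrable (fun ω ↦ Real.exp (-b) * Real.exp (t * X ω)) μ :=
    (hX.integrable_exp_mul t).const_mul _
  have hle : ∫ ω in A, (t * X ω + (1 - b)) ∂μ
      ≤ ∫ ω in A, Real.exp (-b) * Real.exp (t * X ω) ∂μ := by
    refine integral_mono ((hX.integrable.const_mul t).integrableOn.add (integrable_const _))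
      hexp.integrableOn fun ω ↦ ?_
    simp only [← Real.exp_add]
    linarith [Real.add_one_le_exp (-b + t * X ω)]
  have hsplit : ∫ ω in A, (t * X ω + (1 - b)) ∂μ
      = t * ∫ ω in A, X ω ∂μ + μ.real A * (1 - b) := by
    rw [integral_add (hX.integrable.const_mul t).integrableOn (integrable_const _),
      integral_const_mul, setIntegral_const, smul_eq_mul]
  have hbound : ∫ ω in A, Real.exp (-b) * Real.exp (t * X ω) ∂μ ≤ μ.real A := calc
    _ ≤ ∫ ω, Real.exp (-b) * Real.exp (t * X ω) ∂μ :=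
      setIntegral_le_integral hexp (ae_of_all _ fun ω ↦ by positivity)
    _ = Real.exp (-b) * mgf X μ t := integral_const_mul _ _
    _ ≤ Real.exp (-b) * Real.exp (c * t ^ 2 / 2) := by gcongr; exact hX.mgf_le t
    _ = μ.real A := by
      rw [← Real.exp_add, hb, one_div, Real.log_inv]
      ring_nf
      exact Real.exp_log hA
  linarith

/-- **Lemma 7**: if `X ~ N(0, σ²)` and `A` is an event with `0 < P(A) < 1`, then
`E[1_A X] ≤ P(A) √(2 σ² log(1/P(A)))`. -/
theorem indicator_gaussian_integral_le
    (Ω : Type) (mΩ : MeasurableSpace Ω) (P : Measure Ω) [IsProbabilityMeasure P]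
    (σ2 : ℝ≥0) (X : Ω → ℝ) (hX : Measure.map X P = gaussianReal 0 σ2)
    (A : Set Ω) (hA : MeasurableSet A) (h0 : 0 < P A) (h1 : P A < 1) :
    ∫ ω in A, X ω ∂P
      ≤ (P A).toReal * Real.sqrt (2 * (σ2 : ℝ) * Real.log (1 / (P A).toReal)) := by
  have hp : 0 < P.real A := ENNReal.toReal_pos h0.ne' (measure_ne_top P A)
  change _ ≤ P.real A * Real.sqrt (2 * σ2 * Real.log (1 / P.real A))
  rw [← div_le_iff₀' hp]
  apply Real.le_sqrt_of_sq_le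
  have hdiscrim : discrim ((σ2 : ℝ) / 2) (-((∫ ω in A, X ω ∂P) / P.real A))
      (Real.log (1 / P.real A)) ≤ 0 := by
    refine discrim_le_zero fun t ↦ ?_
    have h := mul_setIntegral_le_of_hasSubgaussianMGF
      (hasSubgaussianMGF_of_map_eq_gaussianReal hX) hp t
    rw [← div_le_iff₀' hp, mul_div_assoc] at h
    linarith
  rw [discrim] at hdiscrim
  linarith

end GittinsPaper
end

section
/- For every η ∈ (0, 1) and every Δ > 0: Σ_{k=0}^∞ (1 + η)^{k/(1+η)} · exp( −(1 + η)^k Δ² ) ≤ (3/η) · (1/Δ²)^{1/(1+η)}. -/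
open scoped NNReal ENNReal

namespace GittinsPaper

open Real Filter Topology MeasureTheory Set

/-- The lower incomplete Gamma integral. -/
noncomputable def lowerGamma (p u : ℝ) : ℝ := ∫ t in (0 : ℝ)..u, exp (-t) * t ^ (p - 1)

lemma lowerGamma_intervalIntegrable {p a b : ℝ} (hp : 0 < p) (ha : 0 ≤ a) (hab : a ≤ b) :
    IntervalIntegrable (fun t => exp (-t) * t ^ (p - 1)) volume a b := by
  rw [intervalIntegrable_iff_integrableOn_Ioc_of_le hab]
  exact (GammaIntegral_convergent hp).mono_set fun _ ht => lt_of_le_of_lt ha ht.1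

lemma lowerGamma_nonneg {p u : ℝ} (hu : 0 ≤ u) : 0 ≤ lowerGamma p u :=
  intervalIntegral.integral_nonneg hu fun _ ht =>
    mul_nonneg (exp_pos _).le (rpow_nonneg ht.1 _)

lemma lowerGamma_le_Gamma {p u : ℝ} (hp : 0 < p) (hu : 0 ≤ u) : lowerGamma p u ≤ Gamma p := by
  rw [Gamma_eq_integral hp, lowerGamma, intervalIntegral.integral_of_le hu]
  refine setIntegral_mono_set (GammaIntegral_convergent hp) ?_
    (Filter.Eventually.of_forall fun _ ht => ht.1)
  filter_upwards [ae_restrict_mem measurableSet_Ioi] with t ht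
  exact mul_nonneg (exp_pos _).le (rpow_nonneg (le_of_lt ht) _)

/-- A lower bound for the increments of `lowerGamma`, from `exp (-t) ≥ exp (-u) * (1 + u - t)`. -/
lemma le_lowerGamma_sub {p w u : ℝ} (hp : 0 < p) (hw : 0 < w) (hwu : w ≤ u) :
    exp (-u) * ((1 + u) * ((u ^ p - w ^ p) / p) - (u ^ (p + 1) - w ^ (p + 1)) / (p + 1))
      ≤ lowerGamma p u - lowerGamma p w := by
  have hu : 0 < u := hw.trans_le hwu
  have h0 : (0 : ℝ) ∉ uIcc w u := by
    rw [uIcc_of_le hwu]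
    exact fun h => absurd h.1 (not_le.2 hw)
  have hi : ∀ s : ℝ, IntervalIntegrable (fun t : ℝ => t ^ s) volume w u := fun s =>
    intervalIntegral.intervalIntegrable_rpow (Or.inr h0)
  have e1 : ∫ t in w..u, t ^ (p - 1) = (u ^ p - w ^ p) / p := by
    rw [integral_rpow (Or.inl (by linarith))]
    simp
  have e2 : ∫ t in w..u, t ^ p = (u ^ (p + 1) - w ^ (p + 1)) / (p + 1) :=
    integral_rpow (Or.inl (by linarith))
  rw [lowerGamma, lowerGamma, intervalIntegral.integral_interval_sub_left
    (lowerGamma_intervalIntegrable hp le_rfl hu.le)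
    (lowerGamma_intervalIntegrable hp le_rfl hw.le), ← e1, ← e2,
    ← intervalIntegral.integral_const_mul,
    ← intervalIntegral.integral_sub ((hi _).const_mul _) (hi _),
    ← intervalIntegral.integral_const_mul]
  refine intervalIntegral.integral_mono_on hwu ((((hi _).const_mul _).sub (hi _)).const_mul _)
    (lowerGamma_intervalIntegrable hp hw.le hwu) fun t ht => ?_
  have htpos : 0 < t := hw.trans_le ht.1
  have hsplit : t ^ p = t * t ^ (p - 1) := by
    rw [rpow_sub_one htpos.ne']
    field_simp
  have hexp : exp (-u) * (1 + u - t) ≤ exp (-t) := by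
    have h1 : exp (-t) = exp (-u) * exp (u - t) := by
      rw [← exp_add]
      congr 1
      ring
    rw [h1]
    gcongr
    linarith [add_one_le_exp (u - t)]
  calc exp (-u) * ((1 + u) * t ^ (p - 1) - t ^ p)
      = exp (-u) * (1 + u - t) * t ^ (p - 1) := by rw [hsplit]; ring
    _ ≤ _ := by gcongr

/-- Summing a pointwise bound `c * g u ≤ F u - F (u / r) + l * (g (r * u) - g u)` along a geometric
progression. -/
lemma geometric_tsum_le {g F : ℝ → ℝ} {c l M r x : ℝ} (hr : 1 < r) (hx : 0 < x)
    (hc : 0 < c) (hl : 0 ≤ l) (hg : ∀ u, 0 < u → 0 ≤ g u) (hF : ∀ u, 0 < u → 0 ≤ F u)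
    (hM : ∀ u, 0 < u → F u ≤ M) (hlim : Tendsto g atTop (𝓝 0))
    (h : ∀ u, 0 < u → c * g u ≤ F u - F (u / r) + l * (g (r * u) - g u)) :
    ∑' k : ℕ, g (r ^ k * x) ≤ M / c := by
  have hr0 : 0 < r := by linarith
  have hpos : ∀ k : ℕ, 0 < r ^ k * x := fun k => by positivity
  have hsum : ∀ n : ℕ, c * ∑ k ∈ Finset.range n, g (r ^ k * x) ≤ M + l * g (r ^ n * x) := by
    intro n
    have key : c * ∑ k ∈ Finset.range n, g (r ^ k * x)
        ≤ F (r ^ n * x / r) - F (x / r) + l * (g (r ^ n * x) - g x) := by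
      induction n with
      | zero => simp
      | succ n ih =>
        have h1 := h _ (hpos n)
        have e1 : r ^ (n + 1) * x / r = r ^ n * x := by field_simp; ring
        have e2 : r ^ (n + 1) * x = r * (r ^ n * x) := by ring
        rw [Finset.sum_range_succ, e1, e2]
        linarith
    have h1 := hM _ (div_pos (hpos n) hr0)
    have h2 := hF _ (div_pos hx hr0)
    have h3 := mul_nonneg hl (hg x hx)
    linarith
  refine tsum_le_of_sum_range_le (fun k => hg _ (hpos k)) fun n => ?_
  rw [le_div_iff₀' hc]
  have hlim' : Tendsto (fun m : ℕ => M + l * g (r ^ m * x)) atTop (𝓝 M) := by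
    have := (hlim.comp ((tendsto_pow_atTop_atTop_of_one_lt hr).atTop_mul_const hx)).const_mul l
    simpa using this.const_add M
  refine ge_of_tendsto hlim' (eventually_atTop.2 ⟨n, fun m hm => (?_ : _ ≤ _).trans (hsum m)⟩)
  gcongr
  exact fun k _ _ => hg _ (hpos k)

lemma Gamma_one_div_le {η : ℝ} (h0 : 0 < η) (h1 : η < 1) :
    Gamma (1 / (1 + η)) ≤ (9 + 7 * η) / 9 := by
  have hr : 0 < 1 + η := by linarith
  have hp : 0 < 1 / (1 + η) := by positivity
  have h32 : Gamma (3 / 2) ≤ 8 / 9 := by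
    have e : Gamma (3 / 2) = 1 / 2 * √π := by
      rw [← Gamma_one_half_eq, ← Gamma_add_one (by norm_num)]
      norm_num
    have : √π ≤ 16 / 9 := by
      rw [sqrt_le_left (by norm_num)]
      linarith [pi_lt_d2]
    rw [e]
    linarith
  have hconv := convexOn_Gamma.2 (show (3 / 2 : ℝ) ∈ Ioi 0 by norm_num [mem_Ioi])
    (show (2 : ℝ) ∈ Ioi 0 by norm_num [mem_Ioi])
    (show 0 ≤ 2 * η / (1 + η) by positivity)
    (show 0 ≤ (1 - η) / (1 + η) from div_nonneg (by linarith) hr.le)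
    (by field_simp; ring)
  simp only [smul_eq_mul, Gamma_two] at hconv
  have e : 2 * η / (1 + η) * (3 / 2) + (1 - η) / (1 + η) * 2 = 1 / (1 + η) + 1 := by
    field_simp
    ring
  rw [e, Gamma_add_one hp.ne'] at hconv
  have h2 : 1 / (1 + η) * Gamma (1 / (1 + η))
      ≤ 2 * η / (1 + η) * (8 / 9) + (1 - η) / (1 + η) * 1 :=
    hconv.trans (by gcongr)
  have h3 : 2 * η / (1 + η) * (8 / 9) + (1 - η) / (1 + η) * 1
      = 1 / (1 + η) * ((9 + 7 * η) / 9) := by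
    field_simp
    ring
  rw [h3] at h2
  exact le_of_mul_le_mul_left h2 hp

lemma le_one_sub_rpow {η : ℝ} (h0 : 0 < η) :
    η * ((2 * η ^ 2 + 8 * η + 4) / (η ^ 4 + 8 * η ^ 3 + 21 * η ^ 2 + 16 * η + 4))
      ≤ 1 - ((1 + η) ^ (1 / (1 + η)))⁻¹ := by
  have hr : 0 < 1 + η := by linarith
  set z := 2 * η / (η + 2) / (1 + η) with hz
  have hz0 : 0 ≤ z := by positivity
  have h1 : 1 + z + z ^ 2 / 2 ≤ (1 + η) ^ (1 / (1 + η)) := by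
    refine (quadratic_le_exp_of_nonneg hz0).trans ?_
    rw [rpow_def_of_pos hr, exp_le_exp, hz, ← mul_one_div]
    gcongr
    exact le_log_one_add_of_nonneg h0.le
  have h2 := inv_anti₀ (by positivity) h1
  have h3 : 1 - (1 + z + z ^ 2 / 2)⁻¹
      = η * ((2 * η ^ 2 + 8 * η + 4) / (η ^ 4 + 8 * η ^ 3 + 21 * η ^ 2 + 16 * η + 4)) := by
    rw [hz]
    field_simp
    ring
  linarith

lemma numeric_bound {η A : ℝ} (h0 : 0 < η) (h1 : η < 1)
    (hA : η * ((2 * η ^ 2 + 8 * η + 4) / (η ^ 4 + 8 * η ^ 3 + 21 * η ^ 2 + 16 * η + 4)) ≤ A) :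
    0 ≤ A - (1 - (1 - A) / (1 + η)) / (2 + η) ∧
    η * ((9 + 7 * η) / 9) ≤
      3 * ((1 + η) * (A + (A - (1 - (1 - A) / (1 + η)) / (2 + η)) * A / η)) := by
  set E := η ^ 4 + 8 * η ^ 3 + 21 * η ^ 2 + 16 * η + 4 with hE
  have hEpos : 0 < E := by positivity
  set q := (2 * η ^ 2 + 8 * η + 4) / E with hq
  have hq0 : 0 < q := by positivity
  have hA0 : 0 < A := lt_of_lt_of_le (by positivity) hA
  have hb : A - (1 - (1 - A) / (1 + η)) / (2 + η)
      = (-η / (1 + η) + A * (2 + η - 1 / (1 + η))) / (2 + η) := by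
    field_simp
    ring
  have hcoef : 0 ≤ 2 + η - 1 / (1 + η) := by
    have : 1 / (1 + η) ≤ 1 := by
      rw [div_le_one (by linarith)]
      linarith
    linarith
  have hb' : η * (η * (η + 1) * (η + 4) / (E * (η + 2)))
      ≤ A - (1 - (1 - A) / (1 + η)) / (2 + η) := by
    rw [hb]
    calc η * (η * (η + 1) * (η + 4) / (E * (η + 2)))
        = (-η / (1 + η) + (η * q) * (2 + η - 1 / (1 + η))) / (2 + η) := by
          rw [hq]
          field_simp
          rw [hE]
          ring
      _ ≤ _ := by gcongr
  set b := A - (1 - (1 - A) / (1 + η)) / (2 + η)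
  have hb0 : 0 ≤ b := le_trans (by positivity) hb'
  refine ⟨hb0, ?_⟩
  have hpoly : (9 + 7 * η) * (E ^ 2 * (η + 2)) ≤
      27 * (1 + η) * ((2 * η ^ 2 + 8 * η + 4) * (E * (η + 2) + η * (η + 1) * (η + 4))) := by
    have hk : ∀ k l : ℕ, k ≤ l → η ^ l ≤ η ^ k := fun k l hkl =>
      pow_le_pow_of_le_one h0.le h1.le hkl
    rw [hE]
    linarith [hk 1 3 (by norm_num), hk 2 3 (by norm_num), hk 3 4 (by norm_num),
      hk 3 5 (by norm_num), hk 3 6 (by norm_num), hk 3 7 (by norm_num), hk 3 8 (by norm_num),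
      hk 3 9 (by norm_num), hk 3 10 (by norm_num), pow_pos h0 3]
  calc η * ((9 + 7 * η) / 9)
      ≤ 3 * ((1 + η) * (η * q + η * (η * (η + 1) * (η + 4) / (E * (η + 2))) * (η * q) / η)) := by
        have e : 3 * ((1 + η) * (η * q +
            η * (η * (η + 1) * (η + 4) / (E * (η + 2))) * (η * q) / η))
            = η * ((27 * (1 + η) * ((2 * η ^ 2 + 8 * η + 4) *
              (E * (η + 2) + η * (η + 1) * (η + 4)))) / (E ^ 2 * (η + 2)) / 9) := by
          rw [hq]
          field_simp
          ring
        rw [e]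
        gcongr
        rwa [le_div_iff₀ (by positivity)]
    _ ≤ _ := by gcongr

/-- The pointwise bound whose sum along a geometric progression telescopes. -/
lemma rpow_mul_exp_le_telescoping {η A b u : ℝ} (h0 : 0 < η) (hu : 0 < u)
    (hA : A = 1 - ((1 + η) ^ (1 / (1 + η)))⁻¹)
    (hb : b = A - (1 - (1 - A) / (1 + η)) / (2 + η)) (hb0 : 0 ≤ b) :
    (1 + η) * (A + b * A / η) * (u ^ (1 / (1 + η)) * exp (-u)) ≤
      lowerGamma (1 / (1 + η)) u - lowerGamma (1 / (1 + η)) (u / (1 + η)) +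
        (1 + η) * b * (1 - A) / η *
          (((1 + η) * u) ^ (1 / (1 + η)) * exp (-((1 + η) * u)) -
            u ^ (1 / (1 + η)) * exp (-u)) := by
  have hr : 0 < 1 + η := by linarith
  set p := 1 / (1 + η) with hp
  have hp0 : 0 < p := by positivity
  have hs : 0 < (1 + η) ^ p := rpow_pos_of_pos hr _
  have hsA : (1 + η) ^ p * (1 - A) = 1 := by
    rw [hA]
    field_simp
    ring
  have hA1 : 0 < 1 - A := by
    rw [hA]
    simpa using hs
  have hwp : (u / (1 + η)) ^ p = u ^ p * (1 - A) := by
    rw [div_rpow hu.le hr.le, hA]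
    field_simp
    ring
  have hcell := le_lowerGamma_sub hp0 (div_pos hu hr) (div_le_self hu.le (by linarith))
  rw [rpow_add_one hu.ne', rpow_add_one (div_pos hu hr).ne', hwp] at hcell
  have hcell' : exp (-u) * ((1 + u) * ((u ^ p - u ^ p * (1 - A)) / p) -
      (u ^ p * u - u ^ p * (1 - A) * (u / (1 + η))) / (p + 1))
      = (1 + η) * (A + b * u) * (u ^ p * exp (-u)) := by
    rw [hb, hp]
    have : 1 / (1 + η) + 1 = (2 + η) / (1 + η) := by
      field_simp
      ring
    rw [this]
    field_simp
    ring
  rw [hcell'] at hcell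
  have hexp : exp (-u) * (1 - η * u) ≤ exp (-((1 + η) * u)) := by
    have e : exp (-((1 + η) * u)) = exp (-u) * exp (-(η * u)) := by
      rw [← exp_add]
      congr 1
      ring
    rw [e]
    gcongr
    exact one_sub_le_exp_neg _
  have hshift : u ^ p * exp (-u) * (A - η * u) ≤
      (1 - A) * (((1 + η) * u) ^ p * exp (-((1 + η) * u)) - u ^ p * exp (-u)) := by
    rw [mul_rpow hr.le hu.le]
    have e : (1 - A) * ((1 + η) ^ p * u ^ p * exp (-((1 + η) * u)) - u ^ p * exp (-u))
        = u ^ p * exp (-((1 + η) * u)) - (1 - A) * (u ^ p * exp (-u)) := by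
      linear_combination (u ^ p * exp (-((1 + η) * u))) * hsA
    rw [e]
    have := mul_le_mul_of_nonneg_left hexp (rpow_pos_of_pos hu p).le
    linarith
  have h2 := mul_le_mul_of_nonneg_left hshift (show 0 ≤ (1 + η) * b / η by positivity)
  have e3 : (1 + η) * (A + b * A / η) * (u ^ p * exp (-u))
      = (1 + η) * (A + b * u) * (u ^ p * exp (-u)) +
        (1 + η) * b / η * (u ^ p * exp (-u) * (A - η * u)) := by
    field_simp
    ring
  rw [e3]
  refine (add_le_add hcell h2).trans (le_of_eq ?_)
  ring

/-- **Lemma 12 (technical lemma)**: for every `η ∈ (0,1)` and `Δ > 0`,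
`Σ_{k=0}^∞ (1+η)^{k/(1+η)} exp(-(1+η)^k Δ²) ≤ (3/η) (1/Δ²)^{1/(1+η)}`. -/
theorem geometric_exp_sum_le (η Δ : ℝ) (hη : η ∈ Set.Ioo (0 : ℝ) 1) (hΔ : 0 < Δ) :
    ∑' k : ℕ, (1 + η) ^ ((k : ℝ) / (1 + η)) * Real.exp (-(1 + η) ^ k * Δ ^ 2)
      ≤ 3 / η * (1 / Δ ^ 2) ^ ((1 : ℝ) / (1 + η)) := by
  obtain ⟨h0, h1⟩ := hη
  have hr : 0 < 1 + η := by linarith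
  have hx : 0 < Δ ^ 2 := by positivity
  have hp : 0 < 1 / (1 + η) := by positivity
  obtain ⟨A, hA⟩ : ∃ A, A = 1 - ((1 + η) ^ (1 / (1 + η)))⁻¹ := ⟨_, rfl⟩
  obtain ⟨b, hb⟩ : ∃ b, b = A - (1 - (1 - A) / (1 + η)) / (2 + η) := ⟨_, rfl⟩
  have hAle := le_one_sub_rpow h0
  rw [← hA] at hAle
  have hA0 : 0 < A := lt_of_lt_of_le (by positivity) hAle
  have hA1 : 0 < 1 - A := by
    rw [hA]
    simpa using rpow_pos_of_pos hr _
  obtain ⟨hb0, hnum⟩ := numeric_bound h0 h1 hAle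
  rw [← hb] at hb0 hnum
  set p := 1 / (1 + η) with hpdef
  have hc : 0 < (1 + η) * (A + b * A / η) := by positivity
  have hsum : ∑' k : ℕ, ((1 + η) ^ k * Δ ^ 2) ^ p * exp (-((1 + η) ^ k * Δ ^ 2))
      ≤ Gamma p / ((1 + η) * (A + b * A / η)) :=
    geometric_tsum_le (g := fun u => u ^ p * exp (-u)) (F := lowerGamma p)
      (l := (1 + η) * b * (1 - A) / η) (by linarith) hx hc (by positivity)
      (fun u hu => by positivity) (fun u hu => lowerGamma_nonneg hu.le)
      (fun u hu => lowerGamma_le_Gamma hp hu.le)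
      (by simpa using tendsto_rpow_mul_exp_neg_mul_atTop_nhds_zero p 1 one_pos)
      (fun u hu => rpow_mul_exp_le_telescoping h0 hu hA hb hb0)
  have hbound : Gamma p / ((1 + η) * (A + b * A / η)) ≤ 3 / η := by
    rw [div_le_div_iff₀ hc h0, mul_comm (Gamma p)]
    exact (mul_le_mul_of_nonneg_left (Gamma_one_div_le h0 h1) h0.le).trans hnum
  have hterm : ∀ k : ℕ, (1 + η) ^ ((k : ℝ) / (1 + η)) * exp (-(1 + η) ^ k * Δ ^ 2)
      = (1 / Δ ^ 2) ^ p * (((1 + η) ^ k * Δ ^ 2) ^ p * exp (-((1 + η) ^ k * Δ ^ 2))) := by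
    intro k
    have e : (k : ℝ) / (1 + η) = k * p := by
      rw [hpdef]
      ring
    have hxp : 0 < (Δ ^ 2) ^ p := rpow_pos_of_pos hx _
    rw [e, rpow_mul hr.le, rpow_natCast, mul_rpow (by positivity) hx.le,
      div_rpow zero_le_one hx.le, one_rpow, neg_mul]
    field_simp
  rw [tsum_congr hterm, tsum_mul_left, mul_comm]
  gcongr
  exact hsum.trans hbound

end GittinsPaper
end

section
/- Define f(β) = (1/β)·√(1/(2π)) − √(log(β)/2) · Erfc(√(log β)) for β ≥ 1, where Erfc(x) = (2/√π) ∫_x^∞ exp(−y²) dy. Then: (1) lim_{β → ∞} f(β) · β · log(β) = 1/√(8π); (2) f(β) ≥ 1/(10 β log β) for all β ≥ 3; and (3) f(β) ≤ (1/√(8π)) · 1/(β log β) for all β > 1. -/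
open scoped NNReal ENNReal

namespace GittinsPaper

/-- The complementary error function `Erfc(x) = (2/√π) ∫_x^∞ exp(-y²) dy`. -/
noncomputable def Erfc (x : ℝ) : ℝ :=
  2 / Real.sqrt Real.pi * ∫ y in Set.Ioi x, Real.exp (-y ^ 2)

/-- `f(β) = (1/β) √(1/(2π)) - √(log(β)/2) Erfc(√(log β))`. -/
noncomputable def f (β : ℝ) : ℝ :=
  1 / β * Real.sqrt (1 / (2 * Real.pi))
    - Real.sqrt (Real.log β / 2) * Erfc (Real.sqrt (Real.log β))

/-- The Gaussian tail integral `∫_x^∞ exp(-y²) dy`. -/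
noncomputable def gaussianTail (x : ℝ) : ℝ := ∫ y in Set.Ioi x, Real.exp (-y ^ 2)

lemma integrable_exp_neg_sq : MeasureTheory.Integrable (fun y : ℝ => Real.exp (-y ^ 2)) := by
  simpa using integrable_exp_neg_mul_sq (b := 1) one_pos

lemma gaussianTail_eq_sub (x : ℝ) :
    gaussianTail x = gaussianTail 0 - ∫ y in (0 : ℝ)..x, Real.exp (-y ^ 2) := by
  have h := intervalIntegral.integral_interval_add_Ioi (a := 0) (b := x)
    (integrable_exp_neg_sq.integrableOn) (integrable_exp_neg_sq.integrableOn)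
  unfold gaussianTail
  linarith

lemma hasDerivAt_gaussianTail (x : ℝ) :
    HasDerivAt gaussianTail (-Real.exp (-x ^ 2)) x := by
  have hc : Continuous fun y : ℝ => Real.exp (-y ^ 2) := by fun_prop
  have h := (hc.integral_hasStrictDerivAt 0 x).hasDerivAt.const_sub (gaussianTail 0)
  exact h.congr_of_eventuallyEq (Filter.Eventually.of_forall gaussianTail_eq_sub)

lemma tendsto_gaussianTail_atTop : Filter.Tendsto gaussianTail Filter.atTop (nhds 0) := by
  have h := MeasureTheory.intervalIntegral_tendsto_integral_Ioi (μ := MeasureTheory.volume) (0 : ℝ)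
    integrable_exp_neg_sq.integrableOn Filter.tendsto_id
  have h2 := h.const_sub (gaussianTail 0)
  have h3 : gaussianTail 0 - ∫ y in Set.Ioi (0 : ℝ), Real.exp (-y ^ 2) = 0 := sub_self _
  rw [h3] at h2
  exact h2.congr fun x => (gaussianTail_eq_sub x).symm

lemma nonneg_of_deriv_nonpos_of_tendsto_zero {D D' : ℝ → ℝ}
    (hD : ∀ y, 0 < y → HasDerivAt D (D' y) y) (hD' : ∀ y, 0 < y → D' y ≤ 0)
    (hlim : Filter.Tendsto D Filter.atTop (nhds 0)) {x : ℝ} (hx : 0 < x) : 0 ≤ D x := by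
  have hanti : AntitoneOn D (Set.Ioi 0) := by
    refine antitoneOn_of_deriv_nonpos (convex_Ioi 0)
      (fun y hy => (hD y hy).continuousAt.continuousWithinAt) ?_ ?_
    · rw [interior_Ioi]
      exact fun y hy => (hD y hy).differentiableAt.differentiableWithinAt
    · rw [interior_Ioi]
      intro y hy
      rw [(hD y hy).deriv]
      exact hD' y hy
  refine le_of_tendsto hlim ?_
  filter_upwards [Filter.eventually_ge_atTop x] with y hy
  exact hanti hx (hx.trans_le hy) hy

lemma tendsto_exp_neg_sq_mul {R : ℝ → ℝ} (h0 : ∀ y, 1 ≤ y → 0 ≤ R y)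
    (h1 : ∀ y, 1 ≤ y → R y ≤ 1) :
    Filter.Tendsto (fun y => Real.exp (-y ^ 2) * R y) Filter.atTop (nhds 0) := by
  have he : Filter.Tendsto (fun y : ℝ => Real.exp (-y ^ 2)) Filter.atTop (nhds 0) :=
    Real.tendsto_exp_neg_atTop_nhds_zero.comp (Filter.tendsto_pow_atTop two_ne_zero)
  refine tendsto_of_tendsto_of_tendsto_of_le_of_le' tendsto_const_nhds he ?_ ?_
  · filter_upwards [Filter.eventually_ge_atTop 1] with y hy
    exact mul_nonneg (Real.exp_pos _).le (h0 y hy)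
  · filter_upwards [Filter.eventually_ge_atTop 1] with y hy
    exact mul_le_of_le_one_right (Real.exp_pos _).le (h1 y hy)

lemma hasDerivAt_exp_neg_sq_mul {R : ℝ → ℝ} {r y : ℝ} (hR : HasDerivAt R r y) :
    HasDerivAt (fun y => Real.exp (-y ^ 2) * R y)
      (Real.exp (-y ^ 2) * (r - 2 * y * R y)) y := by
  have h := ((hasDerivAt_pow 2 y).neg.exp).mul hR
  refine h.congr_deriv ?_
  simp only [Pi.neg_apply]
  push_cast
  ring

lemma gaussianTail_le {R R' : ℝ → ℝ} (h0 : ∀ y, 1 ≤ y → 0 ≤ R y) (h1 : ∀ y, 1 ≤ y → R y ≤ 1)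
    (hR : ∀ y, 0 < y → HasDerivAt R (R' y) y) (hR' : ∀ y, 0 < y → R' y - 2 * y * R y ≤ -1)
    {x : ℝ} (hx : 0 < x) : gaussianTail x ≤ Real.exp (-x ^ 2) * R x := by
  have h := nonneg_of_deriv_nonpos_of_tendsto_zero
    (fun y hy => (hasDerivAt_exp_neg_sq_mul (hR y hy)).sub (hasDerivAt_gaussianTail y))
    (fun y hy => by nlinarith [hR' y hy, Real.exp_pos (-y ^ 2)])
    (sub_zero (0 : ℝ) ▸ (tendsto_exp_neg_sq_mul h0 h1).sub tendsto_gaussianTail_atTop) hx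
  simpa using h

lemma le_gaussianTail {R R' : ℝ → ℝ} (h0 : ∀ y, 1 ≤ y → 0 ≤ R y) (h1 : ∀ y, 1 ≤ y → R y ≤ 1)
    (hR : ∀ y, 0 < y → HasDerivAt R (R' y) y) (hR' : ∀ y, 0 < y → -1 ≤ R' y - 2 * y * R y)
    {x : ℝ} (hx : 0 < x) : Real.exp (-x ^ 2) * R x ≤ gaussianTail x := by
  have h := nonneg_of_deriv_nonpos_of_tendsto_zero
    (fun y hy => (hasDerivAt_gaussianTail y).sub (hasDerivAt_exp_neg_sq_mul (hR y hy)))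
    (fun y hy => by nlinarith [hR' y hy, Real.exp_pos (-y ^ 2)])
    (sub_zero (0 : ℝ) ▸ tendsto_gaussianTail_atTop.sub (tendsto_exp_neg_sq_mul h0 h1)) hx
  simpa using h

lemma exp_neg_sq_mul_le_gaussianTail {x : ℝ} (hx : 0 < x) :
    Real.exp (-x ^ 2) * ((1 - 1 / (2 * x ^ 2)) / (2 * x)) ≤ gaussianTail x := by
  refine le_gaussianTail (R := fun y => (1 - 1 / (2 * y ^ 2)) / (2 * y))
    (R' := fun y => -1 / (2 * y ^ 2) + 3 / (4 * y ^ 4)) ?_ ?_ ?_ ?_ hx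
  · intro y hy
    have : 1 / (2 * y ^ 2) ≤ 1 := by
      rw [div_le_one (by positivity)]; nlinarith
    exact div_nonneg (by linarith) (by linarith)
  · intro y hy
    have : 0 ≤ 1 / (2 * y ^ 2) := by positivity
    show (1 - 1 / (2 * y ^ 2)) / (2 * y) ≤ 1
    rw [div_le_one (by linarith)]
    linarith
  · intro y hy
    have h := ((((hasDerivAt_pow 2 y).const_mul 2).fun_inv (by positivity)).const_sub 1).fun_div
      ((hasDerivAt_id' y).const_mul 2) (by positivity)
    simp only [← one_div] at h
    refine h.congr_deriv ?_
    field_simp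
    ring
  · intro y hy
    have h : -1 / (2 * y ^ 2) + 3 / (4 * y ^ 4) - 2 * y * ((1 - 1 / (2 * y ^ 2)) / (2 * y))
        = -1 + 3 / (4 * y ^ 4) := by
      field_simp
      ring
    rw [h]
    have : 0 < 3 / (4 * y ^ 4) := by positivity
    linarith

/-- A rational lower bound for `1 - 2 x exp(x²) ∫_x^∞ exp(-y²) dy` in terms of `t = x²`. -/
noncomputable def tailDefect (t : ℝ) : ℝ := (50 * t + 96) / (100 * t ^ 2 + 342 * t + 163)

lemma gaussianTail_le_exp_neg_sq_mul {x : ℝ} (hx : 0 < x) :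
    gaussianTail x ≤ Real.exp (-x ^ 2) * ((1 - tailDefect (x ^ 2)) / (2 * x)) := by
  have hd : ∀ y : ℝ, 0 < y → 0 < 100 * (y ^ 2) ^ 2 + 342 * y ^ 2 + 163 := fun y _ => by positivity
  refine gaussianTail_le (R := fun y => (1 - tailDefect (y ^ 2)) / (2 * y))
    (R' := fun y => -((50 * (100 * (y ^ 2) ^ 2 + 342 * y ^ 2 + 163)
      - (50 * y ^ 2 + 96) * (200 * y ^ 2 + 342)) / (100 * (y ^ 2) ^ 2 + 342 * y ^ 2 + 163) ^ 2)
      - (1 - tailDefect (y ^ 2)) / (2 * y ^ 2)) ?_ ?_ ?_ ?_ hx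
  · intro y hy
    have : tailDefect (y ^ 2) ≤ 1 := by
      unfold tailDefect
      rw [div_le_one (hd y (by linarith))]; nlinarith [sq_nonneg y]
    exact div_nonneg (by linarith) (by linarith)
  · intro y hy
    have : 0 ≤ tailDefect (y ^ 2) := by unfold tailDefect; positivity
    show (1 - tailDefect (y ^ 2)) / (2 * y) ≤ 1
    rw [div_le_one (by linarith)]
    linarith
  · intro y hy
    have hn := ((hasDerivAt_pow 2 y).const_mul 50).add_const 96
    have hq := ((((hasDerivAt_pow 2 y).fun_pow 2).const_mul 100).fun_add
      ((hasDerivAt_pow 2 y).const_mul 342)).add_const 163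
    have h := ((hn.fun_div hq (hd y hy).ne').const_sub 1).fun_div
      ((hasDerivAt_id' y).const_mul 2) (by positivity)
    have hd' := (hd y hy).ne'
    unfold tailDefect
    refine h.congr_deriv ?_
    field_simp
    ring
  · intro y hy
    have hp : 0 ≤ 2500 * (y ^ 2) ^ 2 - 10150 * y ^ 2 + 10921 := by
      nlinarith [sq_nonneg (y ^ 2 - 2.03)]
    have hd' := (hd y hy).ne'
    rw [← sub_nonneg]
    have hq : 0 ≤ (2500 * (y ^ 2) ^ 2 - 10150 * y ^ 2 + 10921) /
        (2 * y ^ 2 * (100 * (y ^ 2) ^ 2 + 342 * y ^ 2 + 163) ^ 2) := by positivity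
    refine hq.trans_eq ?_
    unfold tailDefect
    field_simp
    ring

lemma f_eq {β : ℝ} (hβ : 1 < β) :
    f β = 1 / Real.sqrt (2 * Real.pi) *
      (1 / β - 2 * Real.sqrt (Real.log β) * gaussianTail (Real.sqrt (Real.log β))) := by
  unfold f Erfc
  rw [← gaussianTail, Real.sqrt_div (Real.log_pos hβ).le, Real.sqrt_div zero_le_one,
    Real.sqrt_mul zero_le_two, Real.sqrt_one]
  have := Real.sqrt_pos.2 Real.pi_pos
  field_simp

lemma sqrt_eight_mul_pi : Real.sqrt (8 * Real.pi) = 2 * Real.sqrt (2 * Real.pi) := by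
  rw [show 8 * Real.pi = 2 ^ 2 * (2 * Real.pi) by ring, Real.sqrt_mul (by norm_num),
    Real.sqrt_sq zero_le_two]

lemma f_le {β : ℝ} (hβ : 1 < β) :
    f β ≤ 1 / Real.sqrt (8 * Real.pi) * (1 / (β * Real.log β)) := by
  have hL := Real.log_pos hβ
  have hx := Real.sqrt_pos.2 hL
  have h := exp_neg_sq_mul_le_gaussianTail hx
  have hs : 0 < Real.sqrt (2 * Real.pi) := Real.sqrt_pos.2 (by positivity)
  rw [f_eq hβ, sqrt_eight_mul_pi]
  rw [Real.sq_sqrt hL.le, Real.exp_neg, Real.exp_log (by linarith)] at h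
  have h2 := mul_le_mul_of_nonneg_left h (by positivity : 0 ≤ 2 * Real.sqrt (Real.log β))
  have h3 : 2 * Real.sqrt (Real.log β) * (β⁻¹ * ((1 - 1 / (2 * Real.log β)) /
      (2 * Real.sqrt (Real.log β)))) = 1 / β - 1 / (2 * (β * Real.log β)) := by
    field_simp
  rw [h3] at h2
  calc _ ≤ 1 / Real.sqrt (2 * Real.pi) * (1 / (2 * (β * Real.log β))) := by
        gcongr; linarith
    _ = _ := by field_simp

lemma tailDefect_le_f {β : ℝ} (hβ : 1 < β) :
    1 / Real.sqrt (2 * Real.pi) * (tailDefect (Real.log β) / β) ≤ f β := by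
  have hL := Real.log_pos hβ
  have hx := Real.sqrt_pos.2 hL
  have h := gaussianTail_le_exp_neg_sq_mul hx
  rw [f_eq hβ]
  rw [Real.sq_sqrt hL.le, Real.exp_neg, Real.exp_log (by linarith)] at h
  have h2 := mul_le_mul_of_nonneg_left h (by positivity : 0 ≤ 2 * Real.sqrt (Real.log β))
  have h3 : 2 * Real.sqrt (Real.log β) * (β⁻¹ * ((1 - tailDefect (Real.log β)) /
      (2 * Real.sqrt (Real.log β)))) = 1 / β - tailDefect (Real.log β) / β := by
    field_simp
  rw [h3] at h2
  gcongr
  linarith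

lemma tendsto_mul_tailDefect :
    Filter.Tendsto (fun t => t * tailDefect t) Filter.atTop (nhds (1 / 2)) := by
  have h1 : Filter.Tendsto (fun t : ℝ => t⁻¹) Filter.atTop (nhds 0) := tendsto_inv_atTop_zero
  have h2 : Filter.Tendsto (fun t : ℝ => (50 + 96 * t⁻¹) / (100 + 342 * t⁻¹ + 163 * t⁻¹ ^ 2))
      Filter.atTop (nhds ((50 + 96 * 0) / (100 + 342 * 0 + 163 * 0 ^ 2))) :=
    ((h1.const_mul 96).const_add 50).div
      (((h1.const_mul 342).const_add 100).add ((h1.pow 2).const_mul 163)) (by norm_num)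
  norm_num at h2
  refine Filter.Tendsto.congr' ?_ h2
  filter_upwards [Filter.eventually_gt_atTop 0] with t ht
  unfold tailDefect
  field_simp

lemma lt_log_three : 1.095 < Real.log 3 := by
  have h : Real.exp 1.095 * Real.exp (-0.0475) ^ 2 = Real.exp 1 := by
    rw [← Real.exp_nat_mul, ← Real.exp_add]
    norm_num
  have h1 : 0.9525 ≤ Real.exp (-0.0475) := by
    linarith [Real.add_one_le_exp (-0.0475)]
  rw [Real.lt_log_iff_exp_lt (by norm_num)]
  nlinarith [Real.exp_one_lt_d9, Real.exp_pos 1.095,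
    mul_le_mul_of_nonneg_left (pow_le_pow_left₀ (by norm_num) h1 2) (Real.exp_pos 1.095).le]

lemma le_mul_tailDefect {t : ℝ} (ht : 1.095 ≤ t) : 0.2507 ≤ t * tailDefect t := by
  unfold tailDefect
  rw [← mul_div_assoc, le_div_iff₀ (by nlinarith)]
  nlinarith

lemma sqrt_two_mul_pi_le : Real.sqrt (2 * Real.pi) ≤ 2.507 := by
  rw [Real.sqrt_le_left (by norm_num)]
  nlinarith [Real.pi_lt_d4]

/-- **Lemma 13**: (1) `f(β) β log β → 1/√(8π)` as `β → ∞`;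
(2) `f(β) ≥ 1/(10 β log β)` for all `β ≥ 3`;
(3) `f(β) ≤ (1/√(8π)) (1/(β log β))` for all `β > 1`. -/
theorem f_beta_asymptotics :
    Filter.Tendsto (fun β : ℝ => f β * β * Real.log β) Filter.atTop
        (nhds (1 / Real.sqrt (8 * Real.pi)))
    ∧ (∀ β : ℝ, 3 ≤ β → 1 / (10 * β * Real.log β) ≤ f β)
    ∧ (∀ β : ℝ, 1 < β → f β ≤ 1 / Real.sqrt (8 * Real.pi) * (1 / (β * Real.log β))) := by
  have hs : 0 < Real.sqrt (2 * Real.pi) := Real.sqrt_pos.2 (by positivity)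
  refine ⟨?_, fun β hβ => ?_, fun β hβ => f_le hβ⟩
  · have hlow := (tendsto_mul_tailDefect.comp Real.tendsto_log_atTop).const_mul
      (1 / Real.sqrt (2 * Real.pi))
    rw [show 1 / Real.sqrt (2 * Real.pi) * (1 / 2) = 1 / Real.sqrt (8 * Real.pi) by
      rw [sqrt_eight_mul_pi]; field_simp] at hlow
    refine tendsto_of_tendsto_of_tendsto_of_le_of_le' hlow tendsto_const_nhds ?_ ?_
    · filter_upwards [Filter.eventually_gt_atTop 1] with β hβ
      have hL := Real.log_pos hβ
      have h := mul_le_mul_of_nonneg_right (tailDefect_le_f hβ)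
        (by positivity : 0 ≤ β * Real.log β)
      calc _ = 1 / Real.sqrt (2 * Real.pi) * (tailDefect (Real.log β) / β) * (β * Real.log β) := by
            simp only [Function.comp_apply]; field_simp
        _ ≤ _ := h
        _ = _ := by ring
    · filter_upwards [Filter.eventually_gt_atTop 1] with β hβ
      have hL := Real.log_pos hβ
      have h := mul_le_mul_of_nonneg_right (f_le hβ) (by positivity : 0 ≤ β * Real.log β)
      calc _ = f β * (β * Real.log β) := by ring
        _ ≤ _ := h
        _ = _ := by field_simp
  · have hlog : 1.095 ≤ Real.log β :=
      lt_log_three.le.trans (Real.log_le_log (by norm_num) hβ)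
    have hL : 0 < Real.log β := by linarith
    refine le_trans ?_ (tailDefect_le_f (by linarith))
    have h1 := le_mul_tailDefect hlog
    have h2 := sqrt_two_mul_pi_le
    rw [div_mul_div_comm, one_mul, div_le_div_iff₀ (by positivity) (by positivity)]
    nlinarith [mul_le_mul_of_nonneg_right (show Real.sqrt (2 * Real.pi) ≤
      10 * (Real.log β * tailDefect (Real.log β)) by linarith) (by linarith : 0 ≤ β)]

end GittinsPaper
end
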